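/- arXiv:0809.0457 — 2 statements merged into one kernel-verified Lean document; each statement's English description precedes it below -/
import Mathlib

section
/- Let X be a proper, geodesically complete CAT(0) space and G a group acting on X by isometries with full limit set (for instance, with cocompact action). Then the G-action on X is minimal. -/
open Metric Set Filter

universe u v

variable {X : Type u}

/-- An affinely parametrised geodesic segment from `x` to `y`, defined on `[0,1]`. -/
def IsGeodesicSeg [MetricSpace X] (x y : X) (γ : ℝ → X) : Prop :=
  γ 0 = x ∧ γ 1 = y ∧
    ∀ s ∈ Set.Icc (0:ℝ) 1, ∀ t ∈ Set.Icc (0:ℝ) 1, dist (γ s) (γ t) = |s - t| * dist x y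

/-- A CAT(0) space: a geodesic metric space in which every geodesic triangle is at least as
thin as its Euclidean comparison triangle, expressed via the standard comparison
(convexity) inequality along geodesics. -/
class CAT0Space (X : Type u) [MetricSpace X] : Prop where
  exists_geodesic : ∀ x y : X, ∃ γ : ℝ → X, IsGeodesicSeg x y γ
  comparison : ∀ (p x y : X) (γ : ℝ → X), IsGeodesicSeg x y γ → ∀ t ∈ Set.Icc (0:ℝ) 1,
    dist p (γ t) ^ 2 ≤ (1 - t) * dist p x ^ 2 + t * dist p y ^ 2 - t * (1 - t) * dist x y ^ 2

/-- A subset is (geodesically) convex if it contains every geodesic segment between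
any two of its points. -/
def GeoConvex [MetricSpace X] (C : Set X) : Prop :=
  ∀ x ∈ C, ∀ y ∈ C, ∀ γ : ℝ → X, IsGeodesicSeg x y γ → ∀ t ∈ Set.Icc (0:ℝ) 1, γ t ∈ C

/-- Every geodesic segment of positive length extends to a locally isometric embedding
of the whole real line. -/
def GeodesicallyComplete (X : Type u) [MetricSpace X] : Prop :=
  ∀ x y : X, x ≠ y → ∀ γ : ℝ → X, IsGeodesicSeg x y γ →
    ∃ ℓ : ℝ → X,
      (∀ t : ℝ, ∃ ε > (0:ℝ), ∀ s₁ ∈ Set.Ioo (t - ε) (t + ε), ∀ s₂ ∈ Set.Ioo (t - ε) (t + ε),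
        dist (ℓ s₁) (ℓ s₂) = |s₁ - s₂|) ∧
      ∀ t ∈ Set.Icc (0:ℝ) 1, ℓ (t * dist x y) = γ t

/-- A (unit speed) geodesic ray, parametrised by `[0,∞)`. -/
structure GeodesicRay (X : Type u) [MetricSpace X] where
  toFun : ℝ → X
  isom : ∀ s, 0 ≤ s → ∀ t, 0 ≤ t → dist (toFun s) (toFun t) = |s - t|

/-- Two rays are asymptotic if they remain at bounded distance. -/
def GeodesicRay.Asymp [MetricSpace X] (ρ σ : GeodesicRay X) : Prop :=
  ∃ C : ℝ, ∀ t, 0 ≤ t → dist (ρ.toFun t) (σ.toFun t) ≤ C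

theorem GeodesicRay.asymp_equivalence (X : Type u) [MetricSpace X] :
    Equivalence (GeodesicRay.Asymp (X := X)) where
  refl ρ := ⟨0, fun t _ => by simp⟩
  symm := fun {ρ σ} ⟨C, hC⟩ => ⟨C, fun t ht => by rw [dist_comm]; exact hC t ht⟩
  trans := fun {ρ σ τ} ⟨C₁, h₁⟩ ⟨C₂, h₂⟩ =>
    ⟨C₁ + C₂, fun t ht => (dist_triangle (ρ.toFun t) (σ.toFun t) (τ.toFun t)).trans
      (add_le_add (h₁ t ht) (h₂ t ht))⟩

instance GeodesicRay.setoid (X : Type u) [MetricSpace X] : Setoid (GeodesicRay X) :=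
  ⟨GeodesicRay.Asymp, GeodesicRay.asymp_equivalence X⟩

/-- The boundary at infinity: asymptote classes of geodesic rays. -/
def Boundary (X : Type u) [MetricSpace X] : Type u := Quotient (GeodesicRay.setoid X)

/-- The boundary point determined by a ray. -/
def GeodesicRay.cls [MetricSpace X] (ρ : GeodesicRay X) : Boundary X := Quotient.mk _ ρ

/-- The boundary at infinity of a subset `Y ⊆ X`: classes of rays staying within
bounded distance of `Y`. -/
def boundarySet [MetricSpace X] (Y : Set X) : Set (Boundary X) :=
  {ξ | ∃ ρ : GeodesicRay X, ρ.cls = ξ ∧ ∃ C : ℝ, ∀ t, 0 ≤ t → ∃ y ∈ Y, dist (ρ.toFun t) y ≤ C}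

/-- Composition of a ray with an isometric map. -/
def GeodesicRay.comp [MetricSpace X] (f : X → X) (hf : Isometry f) (ρ : GeodesicRay X) :
    GeodesicRay X :=
  ⟨fun t => f (ρ.toFun t), fun s hs t ht => by simpa [hf.dist_eq] using ρ.isom s hs t ht⟩

/-- The induced map of an isometric map on the boundary at infinity. -/
def Boundary.map [MetricSpace X] (f : X → X) (hf : Isometry f) : Boundary X → Boundary X :=
  Quotient.map (GeodesicRay.comp f hf)
    (fun ρ σ h => by
      obtain ⟨C, hC⟩ := h
      exact ⟨C, fun t ht => by simpa [GeodesicRay.comp, hf.dist_eq] using hC t ht⟩)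

/-- The Euclidean comparison angle at `p` of the points `x, y`. -/
noncomputable def cmpAngle [MetricSpace X] (p x y : X) : ℝ :=
  Real.arccos ((dist p x ^ 2 + dist p y ^ 2 - dist x y ^ 2) / (2 * dist p x * dist p y))

/-- The Alexandrov angle between two geodesic rays issuing from the same point
(in a CAT(0) space, the comparison angles are monotone, so the limit defining the
Alexandrov angle is the infimum of comparison angles). -/
noncomputable def alexAngleRays [MetricSpace X] (ρ σ : ℝ → X) : ℝ :=
  sInf {a | ∃ s, 0 < s ∧ ∃ t, 0 < t ∧ a = cmpAngle (ρ 0) (ρ s) (σ t)}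

/-- The Alexandrov angle between two geodesic segments (parametrised on `[0,1]`)
issuing from the same point. -/
noncomputable def alexAngleSegs [MetricSpace X] (γ δ : ℝ → X) : ℝ :=
  sInf {a | ∃ s ∈ Set.Ioc (0:ℝ) 1, ∃ t ∈ Set.Ioc (0:ℝ) 1, a = cmpAngle (γ 0) (γ s) (δ t)}

/-- The Tits angle between two boundary points: the supremum over basepoints of the
Alexandrov angle between the rays issuing from that basepoint representing them. -/
noncomputable def titsAngle [MetricSpace X] (ξ η : Boundary X) : ℝ :=
  sSup {a | ∃ ρ σ : GeodesicRay X, ρ.toFun 0 = σ.toFun 0 ∧ ρ.cls = ξ ∧ σ.cls = η ∧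
    a = alexAngleRays ρ.toFun σ.toFun}

/-- The circumradius of `Z` within `Y`, with respect to the distance function `d`. -/
noncomputable def circumradiusIn {B : Type v} (d : B → B → ℝ) (Y Z : Set B) : ℝ :=
  sInf ((fun y => sSup ((fun z => d y z) '' Z)) '' Y)

/-- The topology of the Tits boundary, generated by the balls of the Tits angle metric. -/
instance boundaryTopology (X : Type u) [MetricSpace X] : TopologicalSpace (Boundary X) :=
  TopologicalSpace.generateFrom
    {U | ∃ (ξ : Boundary X) (r : ℝ), U = {η | titsAngle ξ η < r}}

/-- Lebesgue covering dimension of a subset `K` is at most `n`: every open cover of `K`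
admits an open refinement covering `K` of multiplicity at most `n+1` on `K`. -/
def CovDimSubsetLE {B : Type v} [TopologicalSpace B] (K : Set B) (n : ℕ) : Prop :=
  ∀ 𝒰 : Set (Set B), (∀ U ∈ 𝒰, IsOpen U) → K ⊆ ⋃₀ 𝒰 →
    ∃ 𝒱 : Set (Set B), (∀ V ∈ 𝒱, IsOpen V) ∧ K ⊆ ⋃₀ 𝒱 ∧
      (∀ V ∈ 𝒱, ∃ U ∈ 𝒰, V ⊆ U) ∧
      ∀ x ∈ K, {V | V ∈ 𝒱 ∧ x ∈ V}.Finite ∧ {V | V ∈ 𝒱 ∧ x ∈ V}.ncard ≤ n + 1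

/-- The Tits boundary is finite-dimensional: the topological dimension of compact
subsets of the Tits boundary is bounded. -/
def FiniteDimTitsBoundary (X : Type u) [MetricSpace X] : Prop :=
  ∃ n : ℕ, ∀ K : Set (Boundary X), IsCompact K → CovDimSubsetLE K n

/-- The topology of uniform convergence on compacta (compact-open topology) on the
isometry group of `X`. -/
instance isomEquivTopology (X : Type u) [MetricSpace X] : TopologicalSpace (X ≃ᵢ X) :=
  TopologicalSpace.induced (fun g : X ≃ᵢ X => (⟨⇑g, g.continuous⟩ : C(X, X)))
    ContinuousMap.compactOpen

/-- A subgroup of the isometry group acts minimally: there is no nonempty proper closed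
convex invariant subset. -/
def MinimalSubgroupAction [MetricSpace X] (G : Subgroup (X ≃ᵢ X)) : Prop :=
  ∀ C : Set X, C.Nonempty → IsClosed C → GeoConvex C →
    (∀ g ∈ G, ∀ x ∈ C, g x ∈ C) → C = Set.univ

section SMulNotions
variable {G : Type v} [Group G] [MulAction G X] [MetricSpace X]

/-- The translation length of `g`. -/
noncomputable def transLength (g : G) : ℝ := sInf (Set.range fun x : X => dist (g • x) x)

/-- `g` acts as an elliptic isometry: it fixes a point. -/
def IsEllipticSMul (g : G) : Prop := ∃ x : X, g • x = x

/-- `g` acts as a hyperbolic isometry: its translation length is positive and attained. -/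
def IsHyperbolicSMul (g : G) : Prop :=
  ∃ x : X, dist (g • x) x = transLength (X := X) g ∧ 0 < dist (g • x) x

end SMulNotions

/-- The Busemann function associated with a geodesic ray, based at `ρ 0`
(the limit exists, hence agrees with the `limsup`). -/
noncomputable def busemann [MetricSpace X] (ρ : GeodesicRay X) (y : X) : ℝ :=
  Filter.limsup (fun t : ℝ => dist (ρ.toFun t) y - dist (ρ.toFun t) (ρ.toFun 0)) Filter.atTop

/-- Convergence of a sequence to a boundary point in the cône topology (in a CAT(0)
space): the sequence escapes to infinity and the geodesics from the basepoint `p` to the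
points of the sequence converge pointwise to the ray from `p` representing `η`. -/
def SeqTendstoBoundary [MetricSpace X] (p : X) (u : ℕ → X) (η : Boundary X) : Prop :=
  Filter.Tendsto (fun n => dist p (u n)) Filter.atTop Filter.atTop ∧
  ∃ σ : GeodesicRay X, σ.toFun 0 = p ∧ σ.cls = η ∧
    ∀ γ : ℕ → ℝ → X, (∀ n, IsGeodesicSeg p (u n) (γ n)) →
      ∀ t, 0 ≤ t →
        Filter.Tendsto (fun n => γ n (t / dist p (u n))) Filter.atTop (nhds (σ.toFun t))

/-- The closed convex hull of a subset. -/
def closedGeoConvexHull [MetricSpace X] (S : Set X) : Set X :=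
  ⋂₀ {C : Set X | IsClosed C ∧ GeoConvex C ∧ S ⊆ C}

/-- A real function is convex if its restriction to every geodesic is convex. -/
def ConvexFun [MetricSpace X] (f : X → ℝ) : Prop :=
  ∀ (x y : X) (γ : ℝ → X), IsGeodesicSeg x y γ →
    ∀ s ∈ Set.Icc (0:ℝ) 1, ∀ t ∈ Set.Icc (0:ℝ) 1, ∀ a b : ℝ, 0 ≤ a → 0 ≤ b → a + b = 1 →
      f (γ (a * s + b * t)) ≤ a * f (γ s) + b * f (γ t)

/-- `X` is boundary-minimal: no proper closed convex subset has full boundary. -/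
def BoundaryMinimal (X : Type u) [MetricSpace X] : Prop :=
  ∀ Y : Set X, IsClosed Y → GeoConvex Y → boundarySet Y = boundarySet (Set.univ : Set X) →
    Y = Set.univ

/-- A geodesic segment with respect to an abstract distance function `d`. -/
def IsGeodesicSegD {B : Type v} (d : B → B → ℝ) (x y : B) (γ : ℝ → B) : Prop :=
  γ 0 = x ∧ γ 1 = y ∧
    ∀ s ∈ Set.Icc (0:ℝ) 1, ∀ t ∈ Set.Icc (0:ℝ) 1, d (γ s) (γ t) = |s - t| * d x y

/-- Convexity with respect to an abstract distance function `d`. -/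
def DConvex {B : Type v} (d : B → B → ℝ) (A : Set B) : Prop :=
  ∀ x ∈ A, ∀ y ∈ A, ∀ γ : ℝ → B, IsGeodesicSegD d x y γ → ∀ t ∈ Set.Icc (0:ℝ) 1, γ t ∈ A

/-- `X` is irreducible: it admits no isometric splitting as an (ℓ²-)product with both
factors containing more than one point. -/
def IrreducibleCAT0 (X : Type u) [MetricSpace X] : Prop :=
  ¬ ∃ (A : Type u) (B : Type u) (_ : MetricSpace A) (_ : MetricSpace B)
      (_ : X ≃ᵢ WithLp 2 (A × B)), Nontrivial A ∧ Nontrivial B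

/-- The forward ray of a geodesic line. -/
def GeodesicRay.ofLineFwd [MetricSpace X] (ℓ : ℝ → X)
    (h : ∀ s t : ℝ, dist (ℓ s) (ℓ t) = |s - t|) : GeodesicRay X :=
  ⟨ℓ, fun s _ t _ => h s t⟩

/-- The backward ray of a geodesic line. -/
def GeodesicRay.ofLineBwd [MetricSpace X] (ℓ : ℝ → X)
    (h : ∀ s t : ℝ, dist (ℓ s) (ℓ t) = |s - t|) : GeodesicRay X :=
  ⟨fun t => ℓ (-t), fun s _ t _ => by
    rw [h (-s) (-t), show (-s) - (-t) = -(s - t) by ring, abs_neg]⟩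

/-- Two boundary points are opposite if they are the two endpoints of a geodesic line. -/
def OppositeBd [MetricSpace X] (ξ η : Boundary X) : Prop :=
  ∃ (ℓ : ℝ → X) (h : ∀ s t : ℝ, dist (ℓ s) (ℓ t) = |s - t|),
    (GeodesicRay.ofLineBwd ℓ h).cls = ξ ∧ (GeodesicRay.ofLineFwd ℓ h).cls = η

/-- An isometry is parabolic if its displacement function does not attain its infimum. -/
def IsParabolicIsom [MetricSpace X] (g : X ≃ᵢ X) : Prop :=
  ¬ ∃ x : X, dist (g x) x = sInf (Set.range fun y : X => dist (g y) y)

/-- The fixed-point set of an isometry in the boundary at infinity. -/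
def boundaryFixedSet [MetricSpace X] (g : X ≃ᵢ X) : Set (Boundary X) :=
  {ξ | Boundary.map (⇑g) g.isometry ξ = ξ}


namespace IsGeodesicSeg

variable [MetricSpace X] {p x y x' y' : X} {γ δ : ℝ → X}

theorem reverse (h : IsGeodesicSeg x y γ) : IsGeodesicSeg y x fun t => γ (1 - t) := by
  obtain ⟨h0, h1, hd⟩ := h
  refine ⟨by simpa using h1, by simpa using h0, fun s hs t ht => ?_⟩
  rw [hd _ ⟨by linarith [hs.2], by linarith [hs.1]⟩ _ ⟨by linarith [ht.2], by linarith [ht.1]⟩,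
    dist_comm y x, show 1 - s - (1 - t) = -(s - t) by ring, abs_neg]

theorem dist_le_of_common_start [CAT0Space X] (hγ : IsGeodesicSeg p x γ)
    (hδ : IsGeodesicSeg p y δ) {s : ℝ} (hs : s ∈ Icc (0 : ℝ) 1) :
    dist (γ s) (δ s) ≤ s * dist x y := by
  have h₁ := CAT0Space.comparison (γ s) p y δ hδ s hs
  have h₂ := CAT0Space.comparison y p x γ hγ s hs
  have h₃ : dist (γ s) p = s * dist p x := by
    have := hγ.2.2 s hs 0 ⟨le_rfl, zero_le_one⟩
    rwa [hγ.1, sub_zero, abs_of_nonneg hs.1] at this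
  rw [h₃] at h₁
  rw [dist_comm y (γ s), dist_comm y p, dist_comm y x] at h₂
  refine abs_le_of_sq_le_sq' ?_ (mul_nonneg hs.1 dist_nonneg) |>.2
  nlinarith [mul_le_mul_of_nonneg_left h₂ hs.1]

/-- The distance function of a CAT(0) space is convex along pairs of geodesic segments. -/
theorem dist_le [CAT0Space X] (hγ : IsGeodesicSeg x y γ) (hδ : IsGeodesicSeg x' y' δ)
    {s : ℝ} (hs : s ∈ Icc (0 : ℝ) 1) :
    dist (γ s) (δ s) ≤ (1 - s) * dist x x' + s * dist y y' := by
  obtain ⟨ε, hε⟩ := CAT0Space.exists_geodesic x y'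
  have h₁ := hγ.dist_le_of_common_start hε hs
  have h₂ := hε.reverse.dist_le_of_common_start hδ.reverse
    (s := 1 - s) ⟨by linarith [hs.2], by linarith [hs.1]⟩
  simp only [sub_sub_cancel] at h₂
  linarith [dist_triangle (γ s) (ε s) (δ s)]

end IsGeodesicSeg

/-- A locally isometric embedding of the real line. -/
def IsLocalGeodesic [MetricSpace X] (ℓ : ℝ → X) : Prop :=
  ∀ t : ℝ, ∃ ε > (0 : ℝ), ∀ s₁ ∈ Ioo (t - ε) (t + ε), ∀ s₂ ∈ Ioo (t - ε) (t + ε),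
    dist (ℓ s₁) (ℓ s₂) = |s₁ - s₂|

namespace IsLocalGeodesic

variable [MetricSpace X] {ℓ : ℝ → X}

theorem continuous (h : IsLocalGeodesic ℓ) : Continuous ℓ := by
  refine continuous_iff_continuousAt.2 fun t => ?_
  obtain ⟨ε, hε, hd⟩ := h t
  refine Metric.continuousAt_iff.2 fun r hr => ⟨min ε r, lt_min hε hr, fun {s} hs => ?_⟩
  rw [Real.dist_eq] at hs
  have hs' := abs_lt.1 (hs.trans_le (min_le_left _ _))
  rw [hd s ⟨by linarith, by linarith⟩ t ⟨by linarith, by linarith⟩]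
  exact hs.trans_le (min_le_right _ _)

theorem dist_le (h : IsLocalGeodesic ℓ) {a b : ℝ} (hab : a ≤ b) :
    dist (ℓ a) (ℓ b) ≤ b - a := by
  have hS : IsClosed ({t | dist (ℓ a) (ℓ t) ≤ t - a} ∩ Icc a b) :=
    (isClosed_le (continuous_const.dist h.continuous) (by fun_prop)).inter isClosed_Icc
  refine hS.Icc_subset_of_forall_exists_gt (by simp) (fun t ht y hy => ?_) ⟨hab, le_rfl⟩
  obtain ⟨ε, hε, hd⟩ := h t
  obtain ⟨m, hm, hm'⟩ := exists_between (lt_min hε (sub_pos.2 hy))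
  have hmε := hm'.trans_le (min_le_left _ _)
  have hmy := hm'.trans_le (min_le_right _ _)
  refine ⟨t + m, ?_, by linarith, by linarith⟩
  have h₁ : dist (ℓ a) (ℓ t) ≤ t - a := ht.1
  have h₂ := hd t ⟨by linarith, by linarith⟩ (t + m) ⟨by linarith, by linarith⟩
  rw [sub_add_cancel_left, abs_neg, abs_of_pos hm] at h₂
  change dist (ℓ a) (ℓ (t + m)) ≤ t + m - a
  linarith [dist_triangle (ℓ a) (ℓ t) (ℓ (t + m))]

theorem isGeodesicSeg_of_dist_eq {a b : ℝ} (hab : a ≤ b)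
    (h : ∀ s ∈ Icc a b, ∀ t ∈ Icc a b, dist (ℓ s) (ℓ t) = |s - t|) :
    IsGeodesicSeg (ℓ a) (ℓ b) fun r => ℓ (a + r * (b - a)) := by
  have hmem : ∀ r ∈ Icc (0 : ℝ) 1, a + r * (b - a) ∈ Icc a b := fun r hr =>
    ⟨by nlinarith [hr.1], by nlinarith [hr.2]⟩
  refine ⟨by simp, by simp, fun s hs t ht => ?_⟩
  rw [h _ (hmem s hs) _ (hmem t ht), h a ⟨le_rfl, hab⟩ b ⟨hab, le_rfl⟩, abs_sub_comm a b,
    ← abs_mul]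
  congr 1
  ring

theorem dist_eq_of_le [CAT0Space X] (h : IsLocalGeodesic ℓ) {a b : ℝ} (hab : a ≤ b) :
    dist (ℓ a) (ℓ b) = b - a := by
  have hS : IsClosed ({t | dist (ℓ a) (ℓ t) = t - a} ∩ Icc a b) :=
    (isClosed_eq (continuous_const.dist h.continuous) (by fun_prop)).inter isClosed_Icc
  refine hS.Icc_subset_of_forall_exists_gt (by simp) (fun t ht y hy => ?_) ⟨hab, le_rfl⟩
  obtain ⟨ht, hat, -⟩ := ht
  change dist (ℓ a) (ℓ t) = t - a at ht
  obtain ⟨ε, hε, hd⟩ := h t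
  rcases hat.eq_or_lt with rfl | hat
  · obtain ⟨m, hm, hm'⟩ := exists_between (lt_min hε (sub_pos.2 hy))
    have hmε := hm'.trans_le (min_le_left _ _)
    have hmy := hm'.trans_le (min_le_right _ _)
    refine ⟨a + m, ?_, by linarith, by linarith⟩
    change dist (ℓ a) (ℓ (a + m)) = a + m - a
    rw [hd a ⟨by linarith, by linarith⟩ (a + m) ⟨by linarith, by linarith⟩,
      sub_add_cancel_left, abs_neg, abs_of_pos hm, add_sub_cancel_left]
  · obtain ⟨m, hm, hm'⟩ := exists_between (lt_min (lt_min hε (sub_pos.2 hy)) (sub_pos.2 hat))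
    have hma := hm'.trans_le (min_le_right _ _)
    have hmε := hm'.trans_le ((min_le_left _ _).trans (min_le_left _ _))
    have hmy := hm'.trans_le ((min_le_left _ _).trans (min_le_right _ _))
    refine ⟨t + m, ?_, by linarith, by linarith⟩
    have hseg := isGeodesicSeg_of_dist_eq (ℓ := ℓ) (a := t - m) (b := t + m) (by linarith)
      fun s hs r hr => hd s ⟨by linarith [hs.1], by linarith [hs.2]⟩
        r ⟨by linarith [hr.1], by linarith [hr.2]⟩
    have hcmp := CAT0Space.comparison (ℓ a) _ _ _ hseg (1 / 2) ⟨by norm_num, by norm_num⟩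
    have hmid : t - m + 1 / 2 * (t + m - (t - m)) = t := by ring
    simp only [hmid] at hcmp
    have hends : dist (ℓ (t - m)) (ℓ (t + m)) = 2 * m := by
      rw [hd _ ⟨by linarith, by linarith⟩ _ ⟨by linarith, by linarith⟩,
        show t - m - (t + m) = -(2 * m) by ring, abs_neg, abs_of_pos (by linarith)]
    have hback := h.dist_le (a := a) (b := t - m) (by linarith)
    have hback_sq := pow_le_pow_left₀ dist_nonneg hback 2
    rw [ht, hends] at hcmp
    refine le_antisymm (h.dist_le (by linarith)) (abs_le_of_sq_le_sq' ?_ dist_nonneg).2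
    nlinarith

/-- In a CAT(0) space, local geodesics are geodesics. -/
theorem dist_eq [CAT0Space X] (h : IsLocalGeodesic ℓ) (s t : ℝ) :
    dist (ℓ s) (ℓ t) = |s - t| := by
  rcases le_total s t with hst | hst
  · rw [h.dist_eq_of_le hst, abs_sub_comm, abs_of_nonneg (sub_nonneg.2 hst)]
  · rw [dist_comm, h.dist_eq_of_le hst, abs_of_nonneg (sub_nonneg.2 hst)]

end IsLocalGeodesic

/-- A ray which starts in a closed convex set and stays at bounded distance from it is contained
in it. -/
theorem GeodesicRay.mem_of_infDist_le [MetricSpace X] [CAT0Space X] {C : Set X}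
    (hne : C.Nonempty) (hcl : IsClosed C) (hconv : GeoConvex C) (ρ : GeodesicRay X)
    (h0 : ρ.toFun 0 ∈ C) {K : ℝ} (hK : ∀ t, 0 ≤ t → infDist (ρ.toFun t) C ≤ K)
    {t : ℝ} (ht : 0 ≤ t) : ρ.toFun t ∈ C := by
  have hbound : ∀ᶠ T : ℝ in atTop, infDist (ρ.toFun t) C ≤ t / T * (K + 1) := by
    filter_upwards [eventually_ge_atTop t, eventually_gt_atTop 0] with T htT hT
    obtain ⟨c, hc, hdc⟩ := (infDist_lt_iff hne).1 ((hK T hT.le).trans_lt (lt_add_one K))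
    obtain ⟨δ, hδ⟩ := CAT0Space.exists_geodesic (ρ.toFun 0) c
    have hρ : IsGeodesicSeg (ρ.toFun 0) (ρ.toFun T) fun r => ρ.toFun (0 + r * (T - 0)) :=
      IsLocalGeodesic.isGeodesicSeg_of_dist_eq hT.le fun a ha b hb => ρ.isom a ha.1 b hb.1
    have hmem : t / T ∈ Icc (0 : ℝ) 1 := ⟨by positivity, (div_le_one hT).2 htT⟩
    have hle := hρ.dist_le_of_common_start hδ hmem
    simp only [zero_add, sub_zero, div_mul_cancel₀ t hT.ne'] at hle
    exact (infDist_le_dist_of_mem (hconv _ h0 _ hc δ hδ _ hmem)).trans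
      (hle.trans (mul_le_mul_of_nonneg_left hdc.le hmem.1))
  have hlim : Tendsto (fun T : ℝ => t / T * (K + 1)) atTop (nhds 0) := by
    simpa using (tendsto_id.const_div_atTop t).mul_const (K + 1)
  exact (hcl.mem_iff_infDist_zero hne).2
    (le_antisymm (ge_of_tendsto hlim hbound) infDist_nonneg)

/-- A boundary point which is a limit of points at bounded distance from a convex set is
represented by a ray at bounded distance from that set. -/
theorem SeqTendstoBoundary.exists_ray_infDist_le [MetricSpace X] [CAT0Space X] {C : Set X}
    (hconv : GeoConvex C) {x y : X} {u v : ℕ → X} {η : Boundary X}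
    (h : SeqTendstoBoundary x u η) (hy : y ∈ C) (hv : ∀ n, v n ∈ C)
    (huv : ∀ n, dist (u n) (v n) ≤ dist x y) :
    ∃ σ : GeodesicRay X, σ.cls = η ∧ ∀ t, 0 ≤ t → infDist (σ.toFun t) C ≤ dist x y := by
  obtain ⟨htop, σ, -, hσ, hlim⟩ := h
  refine ⟨σ, hσ, fun t ht => ?_⟩
  choose γ hγ using fun n => CAT0Space.exists_geodesic x (u n)
  refine le_of_tendsto (((continuous_infDist_pt C).tendsto _).comp (hlim γ hγ t ht)) ?_
  filter_upwards [htop.eventually_ge_atTop t, htop.eventually_gt_atTop 0] with n hn hpos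
  have hmem : t / dist x (u n) ∈ Icc (0 : ℝ) 1 := ⟨by positivity, (div_le_one hpos).2 hn⟩
  obtain ⟨δ, hδ⟩ := CAT0Space.exists_geodesic y (v n)
  refine (infDist_le_dist_of_mem (hconv _ hy _ (hv n) δ hδ _ hmem)).trans ?_
  refine ((hγ n).dist_le hδ hmem).trans ?_
  nlinarith [mul_le_mul_of_nonneg_left (huv n) hmem.1]

/-- isometric actions with full limit set on proper geodesically
complete CAT(0) spaces are minimal. -/
theorem stmt10 (X : Type u) [MetricSpace X] [ProperSpace X] [CAT0Space X]
    (hgc : GeodesicallyComplete X)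
    (G : Type v) [Group G] [MulAction G X]
    (hiso : ∀ g : G, Isometry (fun x : X => g • x))
    (hfull : ∀ η : Boundary X, ∃ (x : X) (u : ℕ → G),
      SeqTendstoBoundary x (fun n => u n • x) η) :
    ∀ C : Set X, C.Nonempty → IsClosed C → GeoConvex C →
      (∀ g : G, ∀ x ∈ C, g • x ∈ C) → C = Set.univ := by
  intro C hne hcl hconv hinv
  obtain ⟨p, hp⟩ := hne
  refine eq_univ_of_forall fun z => ?_
  rcases eq_or_ne p z with rfl | hpz
  · exact hp
  obtain ⟨γ, hγ⟩ := CAT0Space.exists_geodesic p z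
  obtain ⟨ℓ, hℓ, hℓγ⟩ := hgc p z hpz γ hγ
  have h0 : ℓ 0 = p := by simpa [hγ.1] using hℓγ 0 ⟨le_rfl, zero_le_one⟩
  have h1 : ℓ (dist p z) = z := by simpa [hγ.2.1] using hℓγ 1 ⟨zero_le_one, le_rfl⟩
  let ρ := GeodesicRay.ofLineFwd ℓ (IsLocalGeodesic.dist_eq hℓ)
  obtain ⟨x, u, hu⟩ := hfull ρ.cls
  obtain ⟨σ, hσρ, hσ⟩ := hu.exists_ray_infDist_le hconv hp (fun n => hinv (u n) p hp)
    fun n => ((hiso (u n)).dist_eq x p).le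
  obtain ⟨K, hK⟩ : σ.Asymp ρ := Quotient.exact hσρ
  have hρ : ∀ t, 0 ≤ t → infDist (ρ.toFun t) C ≤ dist x p + K := fun t ht =>
    infDist_le_infDist_add_dist.trans
      (add_le_add (hσ t ht) ((dist_comm _ _).trans_le (hK t ht)))
  have hz : ρ.toFun (dist p z) ∈ C :=
    ρ.mem_of_infDist_le ⟨p, hp⟩ hcl hconv (show ℓ 0 ∈ C from h0.symm ▸ hp) hρ dist_nonneg
  exact h1 ▸ hz
end

section
/- Let X be a proper, geodesically complete CAT(0) space and (C_n)_{n≥0} an increasing sequence of closed convex subsets of X whose union is dense in X. Then every bounded subset of X is contained in some C_n; in particular ⋃_n C_n = X. -/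
open Metric Set Filter

universe u v

variable {X : Type u}

theorem IsGeodesicSeg.reverse_s13 [MetricSpace X] {x y : X} {γ : ℝ → X} (h : IsGeodesicSeg x y γ) :
    IsGeodesicSeg y x (fun t => γ (1 - t)) := by
  obtain ⟨h0, h1, hd⟩ := h
  refine ⟨by simpa using h1, by simpa using h0, fun s hs t ht => ?_⟩
  rw [hd (1 - s) ⟨by linarith [hs.2], by linarith [hs.1]⟩ (1 - t)
    ⟨by linarith [ht.2], by linarith [ht.1]⟩, dist_comm y x, abs_sub_comm s t]
  congr 2
  ring

/-- In a triangle, the segment joining the midpoints of two sides is at most half as long as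
the third side. -/
theorem IsGeodesicSeg.dist_midpoint_le [MetricSpace X] [CAT0Space X] {p x y : X} {γ δ : ℝ → X}
    (hγ : IsGeodesicSeg p x γ) (hδ : IsGeodesicSeg p y δ) :
    dist (γ (1 / 2)) (δ (1 / 2)) ≤ dist x y / 2 := by
  have half_mem : (1 / 2 : ℝ) ∈ Set.Icc (0 : ℝ) 1 := by norm_num
  have h1 := CAT0Space.comparison (γ (1 / 2)) p y δ hδ _ half_mem
  have h2 := CAT0Space.comparison y p x γ hγ _ half_mem
  have h3 : dist (γ (1 / 2)) p = 1 / 2 * dist p x := by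
    have := hγ.2.2 (1 / 2) half_mem 0 (by norm_num)
    rw [hγ.1] at this
    rw [this]
    norm_num
  rw [h3, dist_comm (γ (1 / 2)) y] at h1
  rw [dist_comm y p, dist_comm y x] at h2
  refine le_of_sq_le_sq ?_ (by positivity)
  nlinarith

/-- The distance to a closed convex subset is midpoint-convex along geodesics. -/
theorem IsGeodesicSeg.two_mul_infDist_midpoint_le [MetricSpace X] [ProperSpace X] [CAT0Space X]
    {C : Set X} (hcl : IsClosed C) (hcv : GeoConvex C) (hne : C.Nonempty) {a b : X} {γ : ℝ → X}
    (hγ : IsGeodesicSeg a b γ) :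
    2 * infDist (γ (1 / 2)) C ≤ infDist a C + infDist b C := by
  obtain ⟨a', ha', hda⟩ := hcl.exists_infDist_eq_dist hne a
  obtain ⟨b', hb', hdb⟩ := hcl.exists_infDist_eq_dist hne b
  obtain ⟨δ, hδ⟩ := CAT0Space.exists_geodesic a b'
  obtain ⟨ε, hε⟩ := CAT0Space.exists_geodesic a' b'
  have h1 := hγ.dist_midpoint_le hδ
  have h2 := hδ.reverse_s13.dist_midpoint_le hε.reverse_s13
  norm_num at h1 h2
  have h3 : infDist (γ (1 / 2)) C ≤ dist (γ (1 / 2)) (ε (1 / 2)) :=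
    infDist_le_dist_of_mem (hcv a' ha' b' hb' ε hε _ (by norm_num))
  have h4 := dist_triangle (γ (1 / 2)) (δ (1 / 2)) (ε (1 / 2))
  norm_num at h3 h4
  norm_num
  linarith

/-- A continuous function that is locally midpoint-convex and agrees with the identity at `0` and
at some `d > 0` dominates the identity to the right of `d`. -/
theorem le_of_locally_midpoint_convex {f : ℝ → ℝ} (hf : Continuous f)
    (hmid : ∀ t, ∃ ε > 0, ∀ e, 0 < e → e < ε → 2 * f t ≤ f (t - e) + f (t + e))
    {d : ℝ} (hd : 0 < d) (h0 : f 0 = 0) (hfd : f d = d) {T : ℝ} (hT : d ≤ T) : T ≤ f T := by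
  by_contra! hlt
  have hT0 : 0 < T := hd.trans_le hT
  set k := f T / T with hk
  have hkT : k * T = f T := div_mul_cancel₀ _ hT0.ne'
  have hk1 : k < 1 := (div_lt_one hT0).2 hlt
  set h : ℝ → ℝ := fun t => f t - k * t with hh
  have hcont : Continuous h := by fun_prop
  obtain ⟨m, hm, hmax⟩ := (isCompact_Icc (a := (0 : ℝ)) (b := T)).exists_isMaxOn
    ⟨0, by simp [hT0.le]⟩ hcont.continuousOn
  have hcpt : IsCompact (Set.Icc (0 : ℝ) T ∩ h ⁻¹' {h m}) :=
    isCompact_Icc.inter_right (isClosed_singleton.preimage hcont)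
  obtain ⟨t, ⟨ht, hth⟩, hlast⟩ := hcpt.exists_isGreatest ⟨m, hm, rfl⟩
  have hth : h t = h m := hth
  have hpos : 0 < h m := by
    have h1 : h d ≤ h m := hmax ⟨hd.le, hT⟩
    have h2 : h d = d * (1 - k) := by simp only [hh, hfd]; ring
    have : 0 < d * (1 - k) := mul_pos hd (by linarith)
    linarith
  have ht0 : 0 < t := by
    refine ht.1.lt_of_ne fun hE => ?_
    rw [← hE] at hth
    simp only [hh, h0] at hth hpos
    linarith
  have htT : t < T := by
    refine ht.2.lt_of_ne fun hE => ?_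
    rw [hE] at hth
    simp only [hh] at hth hpos
    linarith
  obtain ⟨ε, hε, hconv⟩ := hmid t
  obtain ⟨e, he0, he⟩ := exists_between (lt_min hε (lt_min ht0 (sub_pos.2 htT)))
  obtain ⟨he1, he2, he3⟩ := by simpa only [lt_min_iff] using he
  have hc := hconv e he0 he1
  have hl : h (t - e) ≤ h m := hmax ⟨by linarith, by linarith⟩
  have hr : h (t + e) ≤ h m := hmax ⟨by linarith, by linarith⟩
  have hr' : h (t + e) ≠ h m := fun hE => by
    have := hlast ⟨⟨by linarith, by linarith⟩, hE⟩
    linarith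
  have hr'' := hr.lt_of_ne hr'
  simp only [hh] at hl hr'' hth
  linarith

/-- A map from `ℝ` to `X` that is isometric near every point. -/
def IsLocalGeodesicLine [MetricSpace X] (ℓ : ℝ → X) : Prop :=
  ∀ t : ℝ, ∃ ε > (0:ℝ), ∀ s₁ ∈ Set.Ioo (t - ε) (t + ε), ∀ s₂ ∈ Set.Ioo (t - ε) (t + ε),
    dist (ℓ s₁) (ℓ s₂) = |s₁ - s₂|

namespace IsLocalGeodesicLine

variable [MetricSpace X] {ℓ : ℝ → X}

theorem continuous (hℓ : IsLocalGeodesicLine ℓ) : Continuous ℓ := by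
  refine continuous_iff_continuousAt.2 fun t => ?_
  obtain ⟨ε, hε, h⟩ := hℓ t
  have hlip : LipschitzOnWith 1 ℓ (Set.Ioo (t - ε) (t + ε)) :=
    LipschitzOnWith.of_dist_le_mul fun x hx y hy => by
      rw [h x hx y hy, Real.dist_eq, NNReal.coe_one, one_mul]
  exact hlip.continuousOn.continuousAt (Ioo_mem_nhds (by linarith) (by linarith))

theorem dist_le (hℓ : IsLocalGeodesicLine ℓ) {a b : ℝ} (hab : a ≤ b) :
    dist (ℓ a) (ℓ b) ≤ b - a := by
  have hcont := hℓ.continuous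
  have hclosed : IsClosed ({t | dist (ℓ a) (ℓ t) ≤ t - a} ∩ Set.Icc a b) :=
    (isClosed_le (by fun_prop) (by fun_prop)).inter isClosed_Icc
  refine hclosed.Icc_subset_of_forall_mem_nhdsWithin (by simp) (fun t ht => ?_)
    (Set.right_mem_Icc.2 hab)
  obtain ⟨ε, hε, h⟩ := hℓ t
  filter_upwards [Ioo_mem_nhdsGT (show t < t + ε by linarith)] with s hs
  have h1 := h t ⟨by linarith, by linarith⟩ s ⟨by linarith [hs.1], hs.2⟩
  rw [abs_of_neg (by linarith [hs.1])] at h1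
  have h2 : dist (ℓ a) (ℓ t) ≤ t - a := ht.1
  have h3 := dist_triangle (ℓ a) (ℓ t) (ℓ s)
  change dist (ℓ a) (ℓ s) ≤ s - a
  linarith

theorem exists_isGeodesicSeg (hℓ : IsLocalGeodesicLine ℓ) (t : ℝ) :
    ∃ ε > 0, ∀ e, 0 < e → e < ε →
      IsGeodesicSeg (ℓ (t - e)) (ℓ (t + e)) (fun s => ℓ (t - e + 2 * e * s)) := by
  obtain ⟨ε, hε, h⟩ := hℓ t
  refine ⟨ε, hε, fun e he0 he => ⟨by simp, by ring_nf, fun s hs r hr => ?_⟩⟩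
  have hmem : ∀ s ∈ Set.Icc (0 : ℝ) 1, t - e + 2 * e * s ∈ Set.Ioo (t - ε) (t + ε) :=
    fun s hs => ⟨by nlinarith [hs.1], by nlinarith [hs.2]⟩
  rw [h _ (hmem s hs) _ (hmem r hr),
    h _ ⟨by linarith, by linarith⟩ _ ⟨by linarith, by linarith⟩,
    show t - e + 2 * e * s - (t - e + 2 * e * r) = (s - r) * (2 * e) by ring,
    show t - e - (t + e) = -(2 * e) by ring, abs_mul, abs_neg]

end IsLocalGeodesicLine

/-- In a geodesically complete space, a point outside a closed convex set can be pushed away to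
distance at least `1` from the set by moving it by at most `1`. -/
theorem GeodesicallyComplete.exists_one_le_dist [MetricSpace X] [ProperSpace X] [CAT0Space X]
    (hgc : GeodesicallyComplete X) {C : Set X} (hcl : IsClosed C) (hcv : GeoConvex C) {x : X}
    (hx : x ∉ C) : ∃ y, dist x y ≤ 1 ∧ ∀ c ∈ C, 1 ≤ dist y c := by
  rcases C.eq_empty_or_nonempty with rfl | hne
  · exact ⟨x, by simp, by simp⟩
  obtain ⟨p, hp, hd⟩ := hcl.exists_infDist_eq_dist hne x
  have hpx : p ≠ x := fun h => hx (h ▸ hp)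
  obtain ⟨γ, hγ⟩ := CAT0Space.exists_geodesic p x
  obtain ⟨ℓ, hloc, hext⟩ := hgc p x hpx γ hγ
  have hℓ : IsLocalGeodesicLine ℓ := hloc
  set d := dist p x
  have hd0 : 0 < d := dist_pos.2 hpx
  have hℓ0 : ℓ 0 = p := by simpa [hγ.1] using hext 0 (by simp)
  have hℓd : ℓ d = x := by simpa [hγ.2.1] using hext 1 (by simp)
  have hfar : d + 1 ≤ infDist (ℓ (d + 1)) C := by
    refine le_of_locally_midpoint_convex (f := fun t => infDist (ℓ t) C)
      ((continuous_infDist_pt C).comp hℓ.continuous) (fun t => ?_) hd0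
      (by simp only [hℓ0, infDist_zero_of_mem hp])
      (by simp only [hℓd, hd, dist_comm x p, d]) (by linarith)
    obtain ⟨ε, hε, h⟩ := hℓ.exists_isGeodesicSeg t
    refine ⟨ε, hε, fun e he0 he => ?_⟩
    have := (h e he0 he).two_mul_infDist_midpoint_le hcl hcv hne
    rwa [show t - e + 2 * e * (1 / 2) = t by ring] at this
  refine ⟨ℓ (d + 1), ?_, fun c hc => ?_⟩
  · have := hℓ.dist_le (show d ≤ d + 1 by linarith)
    rw [hℓd] at this
    linarith
  · linarith [infDist_le_dist_of_mem (x := ℓ (d + 1)) hc]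

/-- an increasing sequence of closed convex sets with dense union in a
geodesically complete proper CAT(0) space exhausts every bounded set. -/
theorem stmt13 (X : Type u) [MetricSpace X] [ProperSpace X] [CAT0Space X]
    (hgc : GeodesicallyComplete X)
    (C : ℕ → Set X) (hcl : ∀ n, IsClosed (C n)) (hcv : ∀ n, GeoConvex (C n))
    (hmono : ∀ n, C n ⊆ C (n + 1)) (hdense : Dense (⋃ n, C n)) :
    (∀ B : Set X, Bornology.IsBounded B → ∃ n, B ⊆ C n) ∧ (⋃ n, C n) = Set.univ := by
  have hbdd : ∀ B : Set X, Bornology.IsBounded B → ∃ n, B ⊆ C n := by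
    intro B hB
    by_contra! hnot
    have hpush : ∀ n, ∃ y ∈ cthickening 1 B, ∀ c ∈ C n, 1 ≤ dist y c := by
      intro n
      obtain ⟨x, hxB, hxC⟩ := Set.not_subset.1 (hnot n)
      obtain ⟨y, hxy, hy⟩ := hgc.exists_one_le_dist (hcl n) (hcv n) hxC
      exact ⟨y, mem_cthickening_of_dist_le y x 1 B hxB (by rwa [dist_comm]), hy⟩
    choose y hyB hyC using hpush
    obtain ⟨z, -, φ, hφ, hz⟩ := tendsto_subseq_of_bounded hB.cthickening hyB
    obtain ⟨c, hc, hzc⟩ := hdense.exists_dist_lt z one_pos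
    obtain ⟨m, hm⟩ := Set.mem_iUnion.1 hc
    have hle : 1 ≤ dist z c := by
      refine ge_of_tendsto (hz.dist tendsto_const_nhds) ?_
      filter_upwards [eventually_ge_atTop m] with n hn
      exact hyC (φ n) c (monotone_nat_of_le_succ hmono (hn.trans (hφ.id_le n)) hm)
    linarith
  refine ⟨hbdd, Set.eq_univ_of_forall fun x => ?_⟩
  obtain ⟨n, hn⟩ := hbdd {x} Bornology.isBounded_singleton
  exact Set.mem_iUnion.2 ⟨n, hn rfl⟩
end
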